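/- arXiv:2303.13246 — 4 statements merged into one kernel-verified Lean document; each statement's English description precedes it below -/
import Mathlib

section
/- Let g : S → ℝ be continuously differentiable, let M, L > 0, and let ρᵈ : ℝ≥0 × S → ℝ be continuously differentiable with ‖ρᵈ(t,·)‖₂ ≤ M and ‖ρᵈ_x(t,·)‖₂ ≤ L for all t ≥ 0. Let K_p > 0 and let e : ℝ≥0 × S → ℝ be a continuously differentiable solution (C¹ in t, C² in x) of the error dynamics e_t(t,x) = −K_p e(t,x) + [ρᵈ(t,·) Ṽ(t,·)]_x(x) − [e(t,·) Ṽ(t,·)]_x(x), where Ṽ(t,·) = g * e(t,·). Then for every γ > 0, if K_p > (M + γ/2)‖g_x‖₂ + L‖g‖₂ and ‖e(0,·)‖₂ < γ, then ‖e(t,·)‖₂ < γ for all t ≥ 0 and ‖e(t,·)‖₂ → 0 as t → ∞. -/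
open MeasureTheory Real Filter

/-- The `L²`-norm on the circle `S = [-π, π]` (endpoints identified). -/
noncomputable def L2norm (h : ℝ → ℝ) : ℝ :=
  Real.sqrt (∫ x in (-Real.pi)..Real.pi, h x ^ 2)

/-- Circular convolution on `S = [-π, π]`. -/
noncomputable def circConv (f g : ℝ → ℝ) : ℝ → ℝ :=
  fun x => ∫ y in (-Real.pi)..Real.pi, f (x - y) * g y

theorem L2norm_nonneg (f : ℝ → ℝ) : 0 ≤ L2norm f := Real.sqrt_nonneg _

theorem neg_pi_le_pi : -Real.pi ≤ Real.pi := by linarith [Real.pi_pos]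

theorem integral_sq_nonneg (f : ℝ → ℝ) : 0 ≤ ∫ x in (-Real.pi)..Real.pi, f x ^ 2 :=
  intervalIntegral.integral_nonneg neg_pi_le_pi fun x _ => sq_nonneg (f x)

theorem L2norm_sq (f : ℝ → ℝ) : L2norm f ^ 2 = ∫ x in (-Real.pi)..Real.pi, f x ^ 2 :=
  Real.sq_sqrt (integral_sq_nonneg f)

theorem L2norm_abs (f : ℝ → ℝ) : L2norm (fun x => |f x|) = L2norm f := by
  simp [L2norm, sq_abs]

/-- Cauchy–Schwarz inequality on the circle. -/
theorem abs_integral_mul_le_L2norm {f h : ℝ → ℝ} (hf : Continuous f) (hh : Continuous h) :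
    |∫ x in (-Real.pi)..Real.pi, f x * h x| ≤ L2norm f * L2norm h := by
  have key : ∀ s : ℝ, 0 ≤ L2norm f ^ 2 * (s * s)
      + (2 * ∫ x in (-Real.pi)..Real.pi, f x * h x) * s + L2norm h ^ 2 := by
    intro s
    have h1 : ∫ x in (-Real.pi)..Real.pi, (s * f x + h x) ^ 2
        = L2norm f ^ 2 * (s * s)
          + (2 * ∫ x in (-Real.pi)..Real.pi, f x * h x) * s + L2norm h ^ 2 := by
      have h2 : ∀ x, (s * f x + h x) ^ 2 = s * s * f x ^ 2 + 2 * s * (f x * h x) + h x ^ 2 :=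
        fun x => by ring
      simp_rw [h2]
      rw [intervalIntegral.integral_add (Continuous.intervalIntegrable (by fun_prop) _ _)
          (Continuous.intervalIntegrable (by fun_prop) _ _),
        intervalIntegral.integral_add (Continuous.intervalIntegrable (by fun_prop) _ _)
          (Continuous.intervalIntegrable (by fun_prop) _ _),
        intervalIntegral.integral_const_mul, intervalIntegral.integral_const_mul,
        L2norm_sq, L2norm_sq]
      ring
    rw [← h1]
    exact integral_sq_nonneg fun x => s * f x + h x
  have hd := discrim_le_zero key
  refine abs_le_of_sq_le_sq ?_ (mul_nonneg (L2norm_nonneg f) (L2norm_nonneg h))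
  unfold discrim at hd
  nlinarith [hd]

theorem abs_integral_mul_mul_le {f h w : ℝ → ℝ} {C : ℝ} (hf : Continuous f) (hh : Continuous h)
    (hw : Continuous w) (hC : ∀ x, |w x| ≤ C) :
    |∫ x in (-Real.pi)..Real.pi, f x * h x * w x| ≤ C * (L2norm f * L2norm h) := by
  have hC0 : 0 ≤ C := (abs_nonneg _).trans (hC 0)
  calc |∫ x in (-Real.pi)..Real.pi, f x * h x * w x|
      ≤ ∫ x in (-Real.pi)..Real.pi, |f x * h x * w x| :=
        intervalIntegral.abs_integral_le_integral_abs neg_pi_le_pi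
    _ ≤ ∫ x in (-Real.pi)..Real.pi, C * (|f x| * |h x|) := by
        refine intervalIntegral.integral_mono_on neg_pi_le_pi
          (Continuous.intervalIntegrable (by fun_prop) _ _)
          (Continuous.intervalIntegrable (by fun_prop) _ _) fun x _ => ?_
        rw [abs_mul, abs_mul, mul_comm]
        exact mul_le_mul_of_nonneg_right (hC x) (by positivity)
    _ = C * ∫ x in (-Real.pi)..Real.pi, |f x| * |h x| := intervalIntegral.integral_const_mul _ _
    _ ≤ C * (L2norm f * L2norm h) := by
        refine mul_le_mul_of_nonneg_left ?_ hC0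
        have := abs_integral_mul_le_L2norm hf.abs hh.abs
        rw [L2norm_abs, L2norm_abs] at this
        exact (le_abs_self _).trans this

theorem L2norm_comp_sub_left {f : ℝ → ℝ} (hf : Function.Periodic f (2 * Real.pi)) (x : ℝ) :
    L2norm (fun y => f (x - y)) = L2norm f := by
  unfold L2norm
  congr 1
  rw [intervalIntegral.integral_comp_sub_left (fun y => f y ^ 2) x]
  have hp : Function.Periodic (fun y => f y ^ 2) (2 * Real.pi) := fun y => by simp only [hf y]
  have := hp.intervalIntegral_add_eq (x - Real.pi) (-Real.pi)
  convert this using 2 <;> ring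

/-- Young's inequality `‖f * h‖_∞ ≤ ‖f‖₂ ‖h‖₂` on the circle. -/
theorem abs_circConv_le {f h : ℝ → ℝ} (hf : Continuous f) (hh : Continuous h)
    (hper : Function.Periodic f (2 * Real.pi)) (x : ℝ) :
    |circConv f h x| ≤ L2norm f * L2norm h := by
  rw [← L2norm_comp_sub_left hper x]
  exact abs_integral_mul_le_L2norm (f := fun y => f (x - y)) (by fun_prop) hh

theorem continuous_circConv {f h : ℝ → ℝ} (hf : Continuous f) (hh : Continuous h) :
    Continuous (circConv f h) := by
  unfold circConv
  exact intervalIntegral.continuous_parametric_intervalIntegral_of_continuous'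
    (by unfold Function.uncurry; fun_prop) _ _

theorem periodic_circConv {f h : ℝ → ℝ} (hper : Function.Periodic f (2 * Real.pi)) :
    Function.Periodic (circConv f h) (2 * Real.pi) := by
  intro x
  unfold circConv
  congr 1
  ext y
  rw [add_sub_right_comm, hper]

/-- Differentiation under the integral sign for jointly continuous derivatives. -/
theorem hasDerivAt_intervalIntegral_of_continuous {F F' : ℝ → ℝ → ℝ}
    (hF : Continuous F.uncurry) (hF' : Continuous F'.uncurry)
    (hd : ∀ s y, HasDerivAt (fun r => F r y) (F' s y) s) (a b s : ℝ) :
    HasDerivAt (fun r => ∫ y in a..b, F r y) (∫ y in a..b, F' s y) s := by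
  obtain ⟨C, hC⟩ := ((isCompact_Icc (a := s - 1) (b := s + 1)).prod
    (isCompact_uIcc (a := a) (b := b))).exists_bound_of_continuousOn hF'.continuousOn
  refine (intervalIntegral.hasDerivAt_integral_of_dominated_loc_of_deriv_le
    (F := F) (F' := F') (s := Set.Icc (s - 1) (s + 1)) (bound := fun _ => C)
    (Icc_mem_nhds (by linarith) (by linarith)) ?_ ?_ ?_ ?_ ?_ ?_).2
  · exact Eventually.of_forall fun r =>
      (hF.comp (Continuous.prodMk_right r)).aestronglyMeasurable
  · exact (hF.comp (Continuous.prodMk_right s)).intervalIntegrable _ _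
  · exact (hF'.comp (Continuous.prodMk_right s)).aestronglyMeasurable
  · exact Eventually.of_forall fun y hy r hr => hC (r, y) ⟨hr, Set.uIoc_subset_uIcc hy⟩
  · exact intervalIntegrable_const
  · exact Eventually.of_forall fun y _ r _ => hd r y

theorem hasDerivAt_circConv {g h : ℝ → ℝ} (hg : ContDiff ℝ 1 g) (hh : Continuous h) (x : ℝ) :
    HasDerivAt (circConv g h) (circConv (deriv g) h x) x := by
  have hg' : Continuous (deriv g) := hg.continuous_deriv le_rfl
  have hgc : Continuous g := hg.continuous
  refine hasDerivAt_intervalIntegral_of_continuous (F := fun x y => g (x - y) * h y)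
    (F' := fun x y => deriv g (x - y) * h y) ?_ ?_ (fun s y => ?_) _ _ x
  · unfold Function.uncurry; fun_prop
  · unfold Function.uncurry; fun_prop
  · have h1 : HasDerivAt g (deriv g (s - y)) (s - y) :=
      (hg.differentiable one_ne_zero _).hasDerivAt
    exact (h1.comp_sub_const s y).mul_const (h y)

theorem Function.Periodic.deriv {f : ℝ → ℝ} {c : ℝ} (hf : Function.Periodic f c) :
    Function.Periodic (deriv f) c := fun x => by
  rw [← deriv_comp_add_const, funext hf]

/-- The energy estimate for the right-hand side of the error dynamics: transport by `v` costs
only half of `‖v_x‖_∞`, after an integration by parts on the circle. -/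
theorem integral_mul_rhs_le {u r v v' : ℝ → ℝ} {K A B : ℝ} (hu : ContDiff ℝ 1 u)
    (hr : ContDiff ℝ 1 r) (hv : ∀ x, HasDerivAt v (v' x) x) (hv' : Continuous v')
    (hup : Function.Periodic u (2 * Real.pi)) (hvp : Function.Periodic v (2 * Real.pi))
    (hA : ∀ x, |v x| ≤ A) (hB : ∀ x, |v' x| ≤ B) :
    ∫ x in (-Real.pi)..Real.pi, u x * (-K * u x + deriv (fun y => r y * v y) x
        - deriv (fun y => u y * v y) x)
      ≤ -K * L2norm u ^ 2 + A * (L2norm u * L2norm (deriv r)) + B * (L2norm u * L2norm r)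
        + B / 2 * L2norm u ^ 2 := by
  have hu' : Continuous (deriv u) := hu.continuous_deriv le_rfl
  have hr' : Continuous (deriv r) := hr.continuous_deriv le_rfl
  have huc := hu.continuous
  have hrc := hr.continuous
  have hvc : Continuous v := continuous_iff_continuousAt.2 fun x => (hv x).continuousAt
  have hud : ∀ x, HasDerivAt u (deriv u x) x :=
    fun x => (hu.differentiable one_ne_zero x).hasDerivAt
  have hrd : ∀ x, HasDerivAt r (deriv r x) x :=
    fun x => (hr.differentiable one_ne_zero x).hasDerivAt
  have hends : ∀ {f : ℝ → ℝ}, Function.Periodic f (2 * Real.pi) → f Real.pi = f (-Real.pi) := by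
    intro f hf
    rw [← hf (-Real.pi)]
    congr 1
    ring
  have hparts : ∫ x in (-Real.pi)..Real.pi, ((deriv u x * u x + u x * deriv u x) * v x
      + u x * u x * v' x) = 0 := by
    rw [intervalIntegral.integral_eq_sub_of_hasDerivAt
      (f := fun x => u x * u x * v x)
      (fun x _ => ((hud x).fun_mul (hud x)).fun_mul (hv x))
      (Continuous.intervalIntegrable (by fun_prop) _ _)]
    simp only [hends hup, hends hvp, sub_self]
  have hsplit : ∀ x, u x * (-K * u x + deriv (fun y => r y * v y) x
      - deriv (fun y => u y * v y) x)
      = -K * u x ^ 2 + u x * deriv r x * v x + u x * r x * v' x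
        + (-(1 / 2)) * (u x * u x * v' x)
        + (-(1 / 2)) * ((deriv u x * u x + u x * deriv u x) * v x + u x * u x * v' x) := by
    intro x
    rw [((hrd x).fun_mul (hv x)).deriv, ((hud x).fun_mul (hv x)).deriv]
    ring
  simp_rw [hsplit]
  have hi : ∀ {f : ℝ → ℝ}, Continuous f → IntervalIntegrable f volume (-Real.pi) Real.pi :=
    fun hf => hf.intervalIntegrable _ _
  rw [intervalIntegral.integral_add (hi (by fun_prop)) (hi (by fun_prop)),
    intervalIntegral.integral_add (hi (by fun_prop)) (hi (by fun_prop)),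
    intervalIntegral.integral_add (hi (by fun_prop)) (hi (by fun_prop)),
    intervalIntegral.integral_add (hi (by fun_prop)) (hi (by fun_prop)),
    intervalIntegral.integral_const_mul, intervalIntegral.integral_const_mul,
    intervalIntegral.integral_const_mul, hparts, ← L2norm_sq]
  have h1 := (abs_le.1 (abs_integral_mul_mul_le huc hr' hvc hA)).2
  have h2 := (abs_le.1 (abs_integral_mul_mul_le huc hrc hv' hB)).2
  have h3 := (abs_le.1 (abs_integral_mul_mul_le huc huc hv' hB)).1
  nlinarith [h1, h2, h3]

/-- Time derivative of the energy `‖e(t,·)‖₂²` of a jointly `C¹` function. -/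
theorem hasDerivAt_L2norm_sq {e : ℝ → ℝ → ℝ} (he : ContDiff ℝ 1 (fun p : ℝ × ℝ => e p.1 p.2))
    {t : ℝ} {d : ℝ → ℝ} (hd : ∀ x, HasDerivAt (fun τ => e τ x) (d x) t) :
    HasDerivAt (fun τ => L2norm (e τ) ^ 2) (2 * ∫ x in (-Real.pi)..Real.pi, e t x * d x) t := by
  set e' : ℝ → ℝ → ℝ := fun τ x => fderiv ℝ (fun p : ℝ × ℝ => e p.1 p.2) (τ, x) (1, 0) with he'
  have hder : ∀ τ x, HasDerivAt (fun s => e s x) (e' τ x) τ := fun τ x =>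
    (he.differentiable one_ne_zero (τ, x)).hasFDerivAt.comp_hasDerivAt (f := fun s => (s, x)) τ
      ((hasDerivAt_id τ).prodMk (hasDerivAt_const τ x))
  have hec : Continuous fun p : ℝ × ℝ => e p.1 p.2 := he.continuous
  have he'c : Continuous fun p : ℝ × ℝ => e' p.1 p.2 :=
    (he.continuous_fderiv one_ne_zero).clm_apply continuous_const
  have hint := hasDerivAt_intervalIntegral_of_continuous (F := fun τ x => e τ x ^ 2)
    (F' := fun τ x => 2 * (e τ x * e' τ x)) (by unfold Function.uncurry; fun_prop)
    (by unfold Function.uncurry; fun_prop)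
    (fun s y => ((hder s y).fun_pow 2).congr_deriv (by norm_num; ring))
    (-Real.pi) Real.pi t
  simp_rw [L2norm_sq]
  convert hint using 1
  rw [← intervalIntegral.integral_const_mul]
  congr 1
  ext x
  rw [(hd x).unique (hder t x)]

/-- **Theorem 1 (LAS with limited sensing capabilities).**
If `K_p > (M + γ/2)‖g_x‖₂ + L‖g‖₂` and `‖e(0,·)‖₂ < γ`, then the error of the
continuification error dynamics stays below `γ` and tends to `0`. -/
theorem limited_sensing_LAS
    (g : ℝ → ℝ) (hg : ContDiff ℝ 1 g) (hgper : Function.Periodic g (2 * Real.pi))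
    (M L : ℝ) (hM : 0 < M) (hL : 0 < L)
    (ρd : ℝ → ℝ → ℝ)
    (hρd : ContDiff ℝ 1 (fun p : ℝ × ℝ => ρd p.1 p.2))
    (hρdper : ∀ t, Function.Periodic (ρd t) (2 * Real.pi))
    (hρdM : ∀ t, 0 ≤ t → L2norm (ρd t) ≤ M)
    (hρdL : ∀ t, 0 ≤ t → L2norm (fun x => deriv (ρd t) x) ≤ L)
    (Kp : ℝ) (hKp : 0 < Kp)
    (e : ℝ → ℝ → ℝ)
    (he1 : ContDiff ℝ 1 (fun p : ℝ × ℝ => e p.1 p.2))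
    (he2 : ∀ t, ContDiff ℝ 2 (e t))
    (heper : ∀ t, Function.Periodic (e t) (2 * Real.pi))
    (hdyn : ∀ t, 0 ≤ t → ∀ x : ℝ,
      HasDerivAt (fun τ => e τ x)
        (-Kp * e t x
          + deriv (fun y => ρd t y * circConv g (e t) y) x
          - deriv (fun y => e t y * circConv g (e t) y) x) t)
    (γ : ℝ) (hγ : 0 < γ)
    (hKpbig : Kp > (M + γ / 2) * L2norm (fun x => deriv g x) + L * L2norm g)
    (h0 : L2norm (e 0) < γ) :
    (∀ t, 0 ≤ t → L2norm (e t) < γ) ∧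
      Tendsto (fun t => L2norm (e t)) atTop (nhds 0) := by
  have hg' : Continuous (deriv g) := hg.continuous_deriv le_rfl
  set G := L2norm g with hG
  set G' := L2norm (fun x => deriv g x) with hG'
  have hG'0 : 0 ≤ G' := L2norm_nonneg _
  have hG0 : 0 ≤ G := L2norm_nonneg _
  set c := Kp - ((M + γ / 2) * G' + L * G) with hc
  have hc0 : 0 < c := by linarith
  set d : ℝ → ℝ → ℝ := fun t x => -Kp * e t x
    + deriv (fun y => ρd t y * circConv g (e t) y) x
    - deriv (fun y => e t y * circConv g (e t) y) x with hd
  set B₀ := (L2norm (e 0) ^ 2 + γ ^ 2) / 2 with hB₀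
  have hsq0 : L2norm (e 0) ^ 2 < γ ^ 2 := pow_lt_pow_left₀ h0 (L2norm_nonneg _) two_ne_zero
  have hB₀pos : 0 < B₀ := by positivity
  have hB₀lt : B₀ < γ ^ 2 := by rw [hB₀]; linarith
  have hexp : ∀ t, 0 ≤ t → B₀ * Real.exp (-c * t) ≤ B₀ := fun t ht =>
    mul_le_of_le_one_right hB₀pos.le (Real.exp_le_one_iff.2 (by nlinarith))
  have hE : ∀ t, 0 ≤ t → HasDerivAt (fun τ => L2norm (e τ) ^ 2)
      (2 * ∫ x in (-Real.pi)..Real.pi, e t x * d t x) t :=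
    fun t ht => hasDerivAt_L2norm_sq he1 (hdyn t ht)
  have hestimate : ∀ t, 0 ≤ t → L2norm (e t) ≤ γ →
      ∫ x in (-Real.pi)..Real.pi, e t x * d t x ≤ -c * L2norm (e t) ^ 2 := by
    intro t ht hle
    have heC : ContDiff ℝ 1 (e t) := (he2 t).of_le one_le_two
    have hρC : ContDiff ℝ 1 (ρd t) :=
      hρd.comp (f := fun x : ℝ => (t, x)) (contDiff_const.prodMk contDiff_id)
    have hmain := integral_mul_rhs_le (K := Kp) heC hρC (hasDerivAt_circConv hg heC.continuous)
      (continuous_circConv hg' heC.continuous) (heper t) (periodic_circConv hgper)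
      (abs_circConv_le hg.continuous heC.continuous hgper)
      (abs_circConv_le hg' heC.continuous hgper.deriv)
    refine hmain.trans ?_
    have hN := L2norm_nonneg (e t)
    have h1 : G * L2norm (e t) * (L2norm (e t) * L2norm (deriv (ρd t)))
        ≤ G * L2norm (e t) * (L2norm (e t) * L) := by
      gcongr
      exact hρdL t ht
    have h2 : G' * L2norm (e t) * (L2norm (e t) * L2norm (ρd t))
        ≤ G' * L2norm (e t) * (L2norm (e t) * M) := by
      gcongr
      exact hρdM t ht
    have h3 : G' * L2norm (e t) / 2 * L2norm (e t) ^ 2 ≤ G' * γ / 2 * L2norm (e t) ^ 2 := by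
      gcongr
    change -Kp * L2norm (e t) ^ 2 + G * L2norm (e t) * (L2norm (e t) * L2norm (deriv (ρd t)))
      + G' * L2norm (e t) * (L2norm (e t) * L2norm (ρd t))
      + G' * L2norm (e t) / 2 * L2norm (e t) ^ 2 ≤ _
    rw [hc]
    linarith
  have hdecay : ∀ t, 0 ≤ t → L2norm (e t) ^ 2 ≤ B₀ * Real.exp (-c * t) := by
    intro T hT
    refine image_le_of_deriv_right_lt_deriv_boundary
      (f := fun τ => L2norm (e τ) ^ 2) (a := 0) (b := T)
      (f' := fun t => 2 * ∫ x in (-Real.pi)..Real.pi, e t x * d t x)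
      (B := fun t => B₀ * Real.exp (-c * t)) (B' := fun t => B₀ * (Real.exp (-c * t) * -c))
      (fun t ht => (hE t ht.1).continuousAt.continuousWithinAt)
      (fun t ht => (hE t ht.1).hasDerivWithinAt) ?_ (fun t => ?_) ?_ ⟨hT, le_rfl⟩
    · simp only [mul_zero, Real.exp_zero, mul_one]
      rw [hB₀]
      linarith
    · simpa using ((((hasDerivAt_id t).const_mul (-c)).exp).const_mul B₀)
    · intro t ht heq
      have hle : L2norm (e t) ≤ γ :=
        (sq_le_sq₀ (L2norm_nonneg _) hγ.le).1 (by linarith [hexp t ht.1])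
      have hpos : 0 < B₀ * Real.exp (-c * t) := by positivity
      have := hestimate t ht.1 hle
      rw [heq] at this
      nlinarith [mul_pos hc0 hpos]
  refine ⟨fun t ht => ?_, ?_⟩
  · exact lt_of_pow_lt_pow_left₀ 2 hγ.le
      (((hdecay t ht).trans (hexp t ht)).trans_lt hB₀lt)
  · have hlim : Tendsto (fun t => Real.sqrt (B₀ * Real.exp (-c * t))) atTop (nhds 0) := by
      have h1 : Tendsto (fun t : ℝ => -c * t) atTop atBot :=
        tendsto_id.const_mul_atTop_of_neg (neg_lt_zero.2 hc0)
      have h2 := ((Real.tendsto_exp_atBot.comp h1).const_mul B₀).sqrt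
      simpa using h2
    refine squeeze_zero' (Eventually.of_forall fun t => L2norm_nonneg _) ?_ hlim
    filter_upwards [eventually_ge_atTop 0] with t ht
    exact Real.le_sqrt_of_sq_le (hdecay t ht)
end

section
/- Let M, L, D₁, D₂ > 0, let ρᵈ : ℝ≥0 × S → ℝ be continuously differentiable with ‖ρᵈ(t,·)‖₂ ≤ M and ‖ρᵈ_x(t,·)‖₂ ≤ L for all t ≥ 0, and let d : ℝ≥0 × S → ℝ be continuously differentiable in x with ‖d(t,·)‖_∞ ≤ D₁ and ‖d_x(t,·)‖_∞ ≤ D₂ for all t ≥ 0. Let K_p > 0 satisfy 2K_p > D₂, and let e : ℝ≥0 × S → ℝ be a continuously differentiable solution of the perturbed error dynamics e_t(t,x) = −K_p e(t,x) + [(ρᵈ(t,·) − e(t,·)) d(t,·)]_x(x). Then ‖e(t,·)‖₂ remains bounded and limsup_{t→∞} ‖e(t,·)‖₂ ≤ (2LD₁ + 2MD₂)/(2K_p − D₂). -/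
open MeasureTheory Real Filter

/-- The `L^∞`-norm (essential supremum) on the circle `S = [-π, π]`. -/
noncomputable def LinfNorm (h : ℝ → ℝ) : ENNReal :=
  MeasureTheory.eLpNorm h ⊤ (MeasureTheory.volume.restrict (Set.Ioc (-Real.pi) Real.pi))

open Set in
/-- Differentiation under the integral sign for a `C¹` integrand on a compact interval. -/
theorem hasDerivAt_intervalIntegral_of_contDiff {F : ℝ × ℝ → ℝ} (hF : ContDiff ℝ 1 F)
    (a b t : ℝ) :
    HasDerivAt (fun τ => ∫ x in a..b, F (τ, x))
      (∫ x in a..b, deriv (fun τ => F (τ, x)) t) t := by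
  have hderiv : ∀ τ x, HasDerivAt (fun σ => F (σ, x)) (fderiv ℝ F (τ, x) (1, 0)) τ := by
    intro τ x
    have hline : HasDerivAt (fun σ : ℝ => (σ, x)) ((1 : ℝ), (0 : ℝ)) τ :=
      (hasDerivAt_id τ).prodMk (hasDerivAt_const τ x)
    exact (hF.differentiable one_ne_zero (τ, x)).hasFDerivAt.comp_hasDerivAt τ hline
  have hcont : Continuous fun p : ℝ × ℝ => fderiv ℝ F p (1, 0) :=
    (hF.continuous_fderiv one_ne_zero).clm_apply continuous_const
  have hFc := hF.continuous
  obtain ⟨C, hC⟩ := ((isCompact_closedBall t 1).prod (isCompact_uIcc (a := a) (b := b)))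
    |>.exists_bound_of_continuousOn hcont.continuousOn
  simp_rw [(hderiv t _).deriv]
  refine (intervalIntegral.hasDerivAt_integral_of_dominated_loc_of_deriv_le
    (F := fun τ x => F (τ, x)) (F' := fun τ x => fderiv ℝ F (τ, x) (1, 0))
    (bound := fun _ => C) (Metric.closedBall_mem_nhds t one_pos) ?_ ?_ ?_ ?_ ?_ ?_).2
  · exact .of_forall fun τ => (hFc.comp (by fun_prop)).aestronglyMeasurable
  · exact (hFc.comp (by fun_prop)).intervalIntegrable _ _
  · exact (hcont.comp (by fun_prop : Continuous fun x : ℝ => (t, x))).aestronglyMeasurable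
  · exact .of_forall fun x hx τ hτ => hC (τ, x) ⟨hτ, uIoc_subset_uIcc hx⟩
  · exact intervalIntegrable_const
  · exact .of_forall fun x _ τ _ => hderiv τ x

theorem ae_abs_le_of_LinfNorm_le {h : ℝ → ℝ} {D : ℝ} (hD : 0 ≤ D)
    (hh : LinfNorm h ≤ ENNReal.ofReal D) :
    ∀ᵐ x ∂volume.restrict (Set.Ioc (-π) π), |h x| ≤ D := by
  rw [LinfNorm, eLpNorm_exponent_top] at hh
  filter_upwards [enorm_ae_le_eLpNormEssSup h (volume.restrict (Set.Ioc (-π) π))] with x hx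
  have := hx.trans hh
  rwa [Real.enorm_eq_ofReal_abs, ENNReal.ofReal_le_ofReal_iff hD] at this

theorem integral_sq_le_of_L2norm_le {h : ℝ → ℝ} {B : ℝ} (hB : 0 ≤ B) (hh : L2norm h ≤ B) :
    ∫ x in (-π)..π, h x ^ 2 ≤ B ^ 2 :=
  (Real.sqrt_le_left hB).1 hh

/-- Weighted Young inequality with a bounded factor. -/
theorem two_mul_mul_mul_le_of_abs_le {c D u r d : ℝ} (hc : 0 < c) (hd : |d| ≤ D) :
    2 * u * r * d ≤ D * (c * u ^ 2 + r ^ 2 / c) := by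
  have hyoung : 2 * |u * r| ≤ c * u ^ 2 + r ^ 2 / c := by
    have hsq : c * u ^ 2 + r ^ 2 / c - 2 * |u * r| = (c * |u| - |r|) ^ 2 / c := by
      rw [abs_mul, ← sq_abs u, ← sq_abs r]
      field_simp
      ring
    have : 0 ≤ (c * |u| - |r|) ^ 2 / c := by positivity
    linarith
  calc 2 * u * r * d ≤ |2 * u * r * d| := le_abs_self _
    _ = |d| * (2 * |u * r|) := by simp only [abs_mul, abs_two]; ring
    _ ≤ D * (c * u ^ 2 + r ^ 2 / c) := by
      have := (abs_nonneg d).trans hd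
      gcongr

/-- Energy estimate for the perturbed error dynamics at a fixed time, with a free Young
parameter `μ`. -/
theorem integral_energy_le {ρ d u : ℝ → ℝ} {M L D₁ D₂ K μ : ℝ}
    (hM : 0 < M) (hL : 0 < L) (hD₁ : 0 ≤ D₁) (hD₂ : 0 ≤ D₂) (hμ : 0 < μ)
    (hρ : ContDiff ℝ 1 ρ) (hd : ContDiff ℝ 1 d) (hu : ContDiff ℝ 1 u)
    (hdper : Function.Periodic d (2 * π)) (huper : Function.Periodic u (2 * π))
    (hρM : ∫ x in (-π)..π, ρ x ^ 2 ≤ M ^ 2) (hρL : ∫ x in (-π)..π, deriv ρ x ^ 2 ≤ L ^ 2)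
    (hdD₁ : ∀ᵐ x ∂volume.restrict (Set.Ioc (-π) π), |d x| ≤ D₁)
    (hdD₂ : ∀ᵐ x ∂volume.restrict (Set.Ioc (-π) π), |deriv d x| ≤ D₂) :
    ∫ x in (-π)..π, 2 * u x * (-K * u x + deriv (fun y => (ρ y - u y) * d y) x) ≤
      (D₂ - 2 * K + μ * (L * D₁ + M * D₂)) * (∫ x in (-π)..π, u x ^ 2) +
        (L * D₁ + M * D₂) / μ := by
  have hρc := hρ.continuous
  have hdc := hd.continuous
  have huc := hu.continuous
  have hρ'c := hρ.continuous_deriv_one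
  have hd'c := hd.continuous_deriv_one
  have hu'c := hu.continuous_deriv_one
  have hρd x := (hρ.differentiable one_ne_zero x).hasDerivAt
  have hdd x := (hd.differentiable one_ne_zero x).hasDerivAt
  have hud x := (hu.differentiable one_ne_zero x).hasDerivAt
  have hprod x : deriv (fun y => (ρ y - u y) * d y) x =
      (deriv ρ x - deriv u x) * d x + (ρ x - u x) * deriv d x :=
    (((hρd x).sub (hud x)).mul (hdd x)).deriv
  simp_rw [hprod]
  have hflux : ∫ x in (-π)..π, (2 * u x * deriv u x * d x + u x ^ 2 * deriv d x) = 0 := by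
    have hder x : HasDerivAt (fun y => u y ^ 2 * d y)
        (2 * u x * deriv u x * d x + u x ^ 2 * deriv d x) x := by
      simpa using ((hud x).fun_pow 2).fun_mul (hdd x)
    rw [intervalIntegral.integral_eq_sub_of_hasDerivAt (fun x _ => hder x)
      (Continuous.intervalIntegrable (by fun_prop) _ _)]
    have hπ : π = -π + 2 * π := by ring
    have h1 : u π = u (-π) := by rw [← huper (-π), ← hπ]
    have h2 : d π = d (-π) := by rw [← hdper (-π), ← hπ]
    rw [h1, h2, sub_self]
  have hint {f : ℝ → ℝ} (hf : Continuous f) : IntervalIntegrable f volume (-π) π :=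
    hf.intervalIntegrable _ _
  calc ∫ x in (-π)..π, 2 * u x *
        (-K * u x + ((deriv ρ x - deriv u x) * d x + (ρ x - u x) * deriv d x))
      ≤ ∫ x in (-π)..π, ((D₂ - 2 * K + μ * (L * D₁ + M * D₂)) * u x ^ 2 +
          D₁ / (L * μ) * deriv ρ x ^ 2 + D₂ / (M * μ) * ρ x ^ 2 -
          (2 * u x * deriv u x * d x + u x ^ 2 * deriv d x)) := by
        refine intervalIntegral.integral_mono_ae_restrict (by linarith [Real.pi_pos])
          (hint (by fun_prop)) (hint (by fun_prop)) ?_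
        rw [restrict_Ioc_eq_restrict_Icc] at hdD₁ hdD₂
        filter_upwards [hdD₁, hdD₂] with x h1 h2
        have hy1 := two_mul_mul_mul_le_of_abs_le (u := u x) (r := deriv ρ x)
          (mul_pos hL hμ) h1
        have hy2 := two_mul_mul_mul_le_of_abs_le (u := u x) (r := ρ x) (mul_pos hM hμ) h2
        have hy3 : u x ^ 2 * -deriv d x ≤ u x ^ 2 * D₂ := by
          gcongr
          exact (neg_le_abs _).trans h2
        have e1 : D₁ / (L * μ) * deriv ρ x ^ 2 = D₁ * (deriv ρ x ^ 2 / (L * μ)) := by ring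
        have e2 : D₂ / (M * μ) * ρ x ^ 2 = D₂ * (ρ x ^ 2 / (M * μ)) := by ring
        rw [e1, e2]
        linarith
    _ = (D₂ - 2 * K + μ * (L * D₁ + M * D₂)) * (∫ x in (-π)..π, u x ^ 2) +
          D₁ / (L * μ) * (∫ x in (-π)..π, deriv ρ x ^ 2) +
          D₂ / (M * μ) * (∫ x in (-π)..π, ρ x ^ 2) := by
        rw [intervalIntegral.integral_sub (hint (by fun_prop)) (hint (by fun_prop)), hflux,
          intervalIntegral.integral_add (hint (by fun_prop)) (hint (by fun_prop)),
          intervalIntegral.integral_add (hint (by fun_prop)) (hint (by fun_prop))]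
        simp only [intervalIntegral.integral_const_mul, sub_zero]
    _ ≤ (D₂ - 2 * K + μ * (L * D₁ + M * D₂)) * (∫ x in (-π)..π, u x ^ 2) +
          D₁ / (L * μ) * L ^ 2 + D₂ / (M * μ) * M ^ 2 := by gcongr
    _ = _ := by field_simp; ring

/-- Grönwall estimate for a scalar dissipative differential inequality on `[0, ∞)`. -/
theorem le_exp_mul_add_of_deriv_le {E E' : ℝ → ℝ} {k B : ℝ}
    (hE : ∀ t, 0 ≤ t → HasDerivAt E (E' t) t)
    (hE' : ∀ t, 0 ≤ t → E' t ≤ -k * (E t - B)) {t : ℝ} (ht : 0 ≤ t) :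
    E t ≤ (E 0 - B) * Real.exp (-k * t) + B := by
  have hder : ∀ s, 0 ≤ s → HasDerivAt (fun s => (E s - B) * Real.exp (k * s))
      (E' s * Real.exp (k * s) + (E s - B) * (Real.exp (k * s) * k)) s := fun s hs =>
    ((hE s hs).sub_const B).mul (by simpa using ((hasDerivAt_id s).const_mul k).exp)
  have hanti : AntitoneOn (fun s => (E s - B) * Real.exp (k * s)) (Set.Ici 0) := by
    refine antitoneOn_of_deriv_nonpos (convex_Ici 0)
      (fun s hs => (hder s hs).continuousAt.continuousWithinAt)
      (fun s hs => (hder s (interior_subset hs)).differentiableAt.differentiableWithinAt)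
      fun s hs => ?_
    rw [(hder s (interior_subset hs)).deriv]
    nlinarith [hE' s (interior_subset hs), Real.exp_pos (k * s)]
  have hle : (E t - B) * Real.exp (k * t) ≤ E 0 - B := by
    simpa using hanti Set.self_mem_Ici ht ht
  have hmul := mul_le_mul_of_nonneg_right hle (Real.exp_pos (-k * t)).le
  rw [mul_assoc, ← Real.exp_add] at hmul
  simp only [neg_mul, add_neg_cancel, Real.exp_zero, mul_one] at hmul ⊢
  linarith

/-- **Theorem 2 (Bounded convergence in the presence of velocity perturbations).**
Under a spatio-temporal velocity-field disturbance `d`, if `2K_p > D₂` then the error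
norm remains bounded and its limsup is at most `(2LD₁ + 2MD₂)/(2K_p − D₂)`. -/
theorem bounded_convergence_velocity_perturbation
    (M L D₁ D₂ : ℝ) (hM : 0 < M) (hL : 0 < L) (hD₁ : 0 < D₁) (hD₂ : 0 < D₂)
    (ρd : ℝ → ℝ → ℝ)
    (hρd : ContDiff ℝ 1 (fun p : ℝ × ℝ => ρd p.1 p.2))
    (hρdper : ∀ t, Function.Periodic (ρd t) (2 * Real.pi))
    (hρdM : ∀ t, 0 ≤ t → L2norm (ρd t) ≤ M)
    (hρdL : ∀ t, 0 ≤ t → L2norm (fun x => deriv (ρd t) x) ≤ L)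
    (d : ℝ → ℝ → ℝ)
    (hd : ∀ t, ContDiff ℝ 1 (d t))
    (hdper : ∀ t, Function.Periodic (d t) (2 * Real.pi))
    (hdD₁ : ∀ t, 0 ≤ t → LinfNorm (d t) ≤ ENNReal.ofReal D₁)
    (hdD₂ : ∀ t, 0 ≤ t → LinfNorm (fun x => deriv (d t) x) ≤ ENNReal.ofReal D₂)
    (Kp : ℝ) (hKp : 0 < Kp) (hKpD₂ : 2 * Kp > D₂)
    (e : ℝ → ℝ → ℝ)
    (he1 : ContDiff ℝ 1 (fun p : ℝ × ℝ => e p.1 p.2))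
    (heper : ∀ t, Function.Periodic (e t) (2 * Real.pi))
    (hdyn : ∀ t, 0 ≤ t → ∀ x : ℝ,
      HasDerivAt (fun τ => e τ x)
        (-Kp * e t x
          + deriv (fun y => (ρd t y - e t y) * d t y) x) t) :
    (∃ C : ℝ, ∀ t, 0 ≤ t → L2norm (e t) ≤ C) ∧
      limsup (fun t => L2norm (e t)) atTop ≤ (2 * L * D₁ + 2 * M * D₂) / (2 * Kp - D₂) := by
  set a := 2 * Kp - D₂ with ha_def
  set c := L * D₁ + M * D₂ with hc_def
  have ha : 0 < a := by linarith
  have hc : 0 < c := by positivity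
  set E : ℝ → ℝ := fun t => ∫ x in (-π)..π, e t x ^ 2
  have hslice {f : ℝ → ℝ → ℝ} (hf : ContDiff ℝ 1 fun p : ℝ × ℝ => f p.1 p.2) (t : ℝ) :
      ContDiff ℝ 1 (f t) :=
    hf.comp (contDiff_const.prodMk contDiff_id : ContDiff ℝ 1 fun x : ℝ => (t, x))
  have hder (t : ℝ) : HasDerivAt E (∫ x in (-π)..π, deriv (fun τ => e τ x ^ 2) t) t :=
    hasDerivAt_intervalIntegral_of_contDiff (F := fun p => e p.1 p.2 ^ 2) (he1.pow 2) (-π) π t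
  have hdecay (t : ℝ) (ht : 0 ≤ t) :
      ∫ x in (-π)..π, deriv (fun τ => e τ x ^ 2) t ≤ -(a / 2) * (E t - (2 * c / a) ^ 2) := by
    have hsq (x : ℝ) : deriv (fun τ => e τ x ^ 2) t =
        2 * e t x * (-Kp * e t x + deriv (fun y => (ρd t y - e t y) * d t y) x) := by
      simpa using ((hdyn t ht x).fun_pow 2).deriv
    simp_rw [hsq]
    refine (integral_energy_le (μ := a / (2 * c)) hM hL hD₁.le hD₂.le (by positivity)
      (hslice hρd t) (hd t) (hslice he1 t) (hdper t) (heper t)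
      (integral_sq_le_of_L2norm_le hM.le (hρdM t ht))
      (integral_sq_le_of_L2norm_le hL.le (hρdL t ht))
      (ae_abs_le_of_LinfNorm_le hD₁.le (hdD₁ t ht))
      (ae_abs_le_of_LinfNorm_le hD₂.le (hdD₂ t ht))).trans_eq ?_
    change (D₂ - 2 * Kp + a / (2 * c) * c) * E t + c / (a / (2 * c)) = _
    have hK : D₂ - 2 * Kp = -a := by rw [ha_def]; ring
    rw [hK]
    field_simp
    ring
  have hbound (t : ℝ) (ht : 0 ≤ t) : L2norm (e t) ≤
      √((E 0 - (2 * c / a) ^ 2) * Real.exp (-(a / 2) * t) + (2 * c / a) ^ 2) :=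
    Real.sqrt_le_sqrt (le_exp_mul_add_of_deriv_le (fun t _ => hder t) hdecay ht)
  have hE0 : 0 ≤ E 0 :=
    intervalIntegral.integral_nonneg (by linarith [Real.pi_pos]) fun x _ => sq_nonneg _
  refine ⟨⟨√(E 0 + (2 * c / a) ^ 2), fun t ht => (hbound t ht).trans (Real.sqrt_le_sqrt ?_)⟩, ?_⟩
  · have hexp : Real.exp (-(a / 2) * t) ≤ 1 := by
      rw [Real.exp_le_one_iff]
      nlinarith
    nlinarith [Real.exp_pos (-(a / 2) * t), sq_nonneg (2 * c / a)]
  · have hlim : Tendsto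
        (fun t => √((E 0 - (2 * c / a) ^ 2) * Real.exp (-(a / 2) * t) + (2 * c / a) ^ 2))
        atTop (nhds (2 * c / a)) := by
      have hexp : Tendsto (fun t : ℝ => Real.exp (-(a / 2) * t)) atTop (nhds 0) :=
        Real.tendsto_exp_atBot.comp
          (tendsto_id.const_mul_atTop_of_neg (by linarith : -(a / 2) < 0))
      have hsqrt := ((hexp.const_mul (E 0 - (2 * c / a) ^ 2)).add_const ((2 * c / a) ^ 2)).sqrt
      rwa [mul_zero, zero_add, Real.sqrt_sq (by positivity)] at hsqrt
    calc limsup (fun t => L2norm (e t)) atTop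
        ≤ limsup (fun t =>
            √((E 0 - (2 * c / a) ^ 2) * Real.exp (-(a / 2) * t) + (2 * c / a) ^ 2)) atTop :=
          limsup_le_limsup ((eventually_ge_atTop 0).mono hbound)
            (isCoboundedUnder_le_of_le atTop (x := 0) fun t => Real.sqrt_nonneg _)
            hlim.isBoundedUnder_le
      _ = 2 * c / a := hlim.limsup_eq
      _ = (2 * L * D₁ + 2 * M * D₂) / a := by rw [hc_def]; ring
end

section
/- Let f, f̂ : S → ℝ be continuously differentiable kernels and set g = f̂ − f. Let ρ, ρᵈ : ℝ≥0 × S → ℝ be continuously differentiable (C¹ in t, C² in x) and define e = ρᵈ − ρ. Suppose ρᵈ satisfies the reference dynamics ρᵈ_t + [ρᵈ (f*ρᵈ)]_x = 0 and ρ satisfies the controlled dynamics ρ_t + [ρ (f*ρ)]_x = q̂ with q̂ = K_p e − [e (f*ρᵈ)]_x − [ρ (f̂*e)]_x, where convolutions are taken in the spatial variable at each time t. Then e satisfies e_t = −K_p e + [ρᵈ (g*e)]_x − [e (g*e)]_x. -/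
open MeasureTheory Real Filter

theorem differentiable_circConv {f g : ℝ → ℝ} (hf : ContDiff ℝ 1 f) (hg : Continuous g) :
    Differentiable ℝ (circConv f g) := by
  intro x₀
  have hf' : Continuous (deriv f) := hf.continuous_deriv le_rfl
  have hfc : Continuous f := hf.continuous
  have hcont : Continuous (fun p : ℝ × ℝ => deriv f (p.1 - p.2) * g p.2) := by fun_prop
  obtain ⟨C, hC⟩ := ((isCompact_closedBall x₀ 1).prod
    (isCompact_uIcc (a := -Real.pi) (b := Real.pi))).exists_bound_of_continuousOn hcont.continuousOn
  refine (intervalIntegral.hasDerivAt_integral_of_dominated_loc_of_deriv_le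
    (F := fun x y => f (x - y) * g y) (F' := fun x y => deriv f (x - y) * g y)
    (bound := fun _ => C) (Metric.closedBall_mem_nhds x₀ one_pos) ?_ ?_ ?_ ?_ ?_ ?_).2.differentiableAt
  · exact Eventually.of_forall fun x =>
      (by fun_prop : Continuous fun y => f (x - y) * g y).aestronglyMeasurable
  · exact (by fun_prop : Continuous fun y => f (x₀ - y) * g y).intervalIntegrable _ _
  · exact (by fun_prop : Continuous fun y => deriv f (x₀ - y) * g y).aestronglyMeasurable
  · exact Eventually.of_forall fun y hy x hx => hC (x, y) ⟨hx, Set.uIoc_subset_uIcc hy⟩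
  · exact intervalIntegrable_const
  · refine Eventually.of_forall fun y _ x _ => ?_
    exact (((hf.differentiable one_ne_zero) (x - y)).hasDerivAt.comp_sub_const x y).mul_const (g y)

theorem circConv_sub_right {f g h : ℝ → ℝ} (hf : Continuous f) (hg : Continuous g)
    (hh : Continuous h) (x : ℝ) :
    circConv f (fun z => g z - h z) x = circConv f g x - circConv f h x := by
  unfold circConv
  rw [← intervalIntegral.integral_sub]
  · simp only [mul_sub]
  · exact (by fun_prop : Continuous fun y => f (x - y) * g y).intervalIntegrable _ _
  · exact (by fun_prop : Continuous fun y => f (x - y) * h y).intervalIntegrable _ _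

theorem circConv_sub_left {f g h : ℝ → ℝ} (hf : Continuous f) (hg : Continuous g)
    (hh : Continuous h) (x : ℝ) :
    circConv (fun z => f z - g z) h x = circConv f h x - circConv g h x := by
  unfold circConv
  rw [← intervalIntegral.integral_sub]
  · simp only [sub_mul]
  · exact (by fun_prop : Continuous fun y => f (x - y) * h y).intervalIntegrable _ _
  · exact (by fun_prop : Continuous fun y => g (x - y) * h y).intervalIntegrable _ _

/-- **Error dynamics with limited sensing (eq. (15) of the paper).**
If `ρᵈ` satisfies the reference dynamics and `ρ` the controlled dynamics with the
control `q̂ = K_p e − [e (f*ρᵈ)]_x − [ρ (f̂*e)]_x`, then `e = ρᵈ − ρ` satisfies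
`e_t = −K_p e + [ρᵈ (g*e)]_x − [e (g*e)]_x`, where `g = f̂ − f`. -/
theorem error_dynamics_limited_sensing
    (f fhat : ℝ → ℝ) (hf : ContDiff ℝ 1 f) (hfhat : ContDiff ℝ 1 fhat)
    (hfper : Function.Periodic f (2 * Real.pi))
    (hfhatper : Function.Periodic fhat (2 * Real.pi))
    (Kp : ℝ)
    (ρ ρd : ℝ → ℝ → ℝ)
    (hρ1 : ContDiff ℝ 1 (fun p : ℝ × ℝ => ρ p.1 p.2))
    (hρ2 : ∀ t, ContDiff ℝ 2 (ρ t))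
    (hρper : ∀ t, Function.Periodic (ρ t) (2 * Real.pi))
    (hρd1 : ContDiff ℝ 1 (fun p : ℝ × ℝ => ρd p.1 p.2))
    (hρd2 : ∀ t, ContDiff ℝ 2 (ρd t))
    (hρdper : ∀ t, Function.Periodic (ρd t) (2 * Real.pi))
    (href : ∀ t, 0 ≤ t → ∀ x : ℝ,
      HasDerivAt (fun τ => ρd τ x)
        (-(deriv (fun y => ρd t y * circConv f (ρd t) y) x)) t)
    (hctrl : ∀ t, 0 ≤ t → ∀ x : ℝ,
      HasDerivAt (fun τ => ρ τ x)
        ((Kp * (ρd t x - ρ t x)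
            - deriv (fun y => (ρd t y - ρ t y) * circConv f (ρd t) y) x
            - deriv (fun y => ρ t y * circConv fhat (fun z => ρd t z - ρ t z) y) x)
          - deriv (fun y => ρ t y * circConv f (ρ t) y) x) t) :
    ∀ t, 0 ≤ t → ∀ x : ℝ,
      HasDerivAt (fun τ => ρd τ x - ρ τ x)
        (-Kp * (ρd t x - ρ t x)
          + deriv (fun y => ρd t y *
              circConv (fun z => fhat z - f z) (fun z => ρd t z - ρ t z) y) x
          - deriv (fun y => (ρd t y - ρ t y) *
              circConv (fun z => fhat z - f z) (fun z => ρd t z - ρ t z) y) x) t := by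
  intro t ht x
  refine ((href t ht x).fun_sub (hctrl t ht x)).congr_deriv ?_
  have hρc : Continuous (ρ t) := (hρ2 t).continuous
  have hρdc : Continuous (ρd t) := (hρd2 t).continuous
  have hr : DifferentiableAt ℝ (ρ t) x := (hρ2 t).differentiable two_ne_zero x
  have hrd : DifferentiableAt ℝ (ρd t) x := (hρd2 t).differentiable two_ne_zero x
  have h₁ := differentiable_circConv hf hρc x
  have h₂ := differentiable_circConv hf hρdc x
  have h₃ := differentiable_circConv hfhat hρc x
  have h₄ := differentiable_circConv hfhat hρdc x
  simp only [circConv_sub_left hfhat.continuous hf.continuous (hρdc.fun_sub hρc),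
    circConv_sub_right hfhat.continuous hρdc hρc, circConv_sub_right hf.continuous hρdc hρc]
  simp (disch := fun_prop) only [deriv_fun_mul, deriv_fun_sub]
  ring
end

section
/- Let ρᵈ : ℝ≥0 × S → ℝ and d : ℝ≥0 × S → ℝ be continuously differentiable, and let e : ℝ≥0 × S → ℝ be a continuously differentiable solution of e_t = −K_p e + [(ρᵈ − e) d]_x. Then for all t ≥ 0, the time derivative of ‖e(t,·)‖₂² equals −2K_p ‖e(t,·)‖₂² − ∫_S e(t,x)² d_x(t,x) dx + 2∫_S ( e(t,x) ρᵈ_x(t,x) d(t,x) + e(t,x) ρᵈ(t,x) d_x(t,x) ) dx. -/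
open MeasureTheory Real Filter

lemma ContDiff.exists_continuous_partial_derivs {f : ℝ → ℝ → ℝ}
    (hf : ContDiff ℝ 1 (fun p : ℝ × ℝ => f p.1 p.2)) :
    ∃ f₁ f₂ : ℝ → ℝ → ℝ,
      Continuous (fun p : ℝ × ℝ => f₁ p.1 p.2) ∧ Continuous (fun p : ℝ × ℝ => f₂ p.1 p.2) ∧
      (∀ t x, HasDerivAt (fun τ => f τ x) (f₁ t x) t) ∧
      (∀ t x, HasDerivAt (f t) (f₂ t x) x) := by
  have hc := hf.continuous_fderiv one_ne_zero
  have hD : ∀ p : ℝ × ℝ, HasFDerivAt (fun p : ℝ × ℝ => f p.1 p.2)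
      (fderiv ℝ (fun p : ℝ × ℝ => f p.1 p.2) p) p :=
    fun p => (hf.differentiable one_ne_zero p).hasFDerivAt
  refine ⟨fun t x => fderiv ℝ (fun p : ℝ × ℝ => f p.1 p.2) (t, x) (1, 0),
    fun t x => fderiv ℝ (fun p : ℝ × ℝ => f p.1 p.2) (t, x) (0, 1),
    hc.clm_apply continuous_const, hc.clm_apply continuous_const, fun t x => ?_, fun t x => ?_⟩
  · exact (hD (t, x)).comp_hasDerivAt t ((hasDerivAt_id t).prodMk (hasDerivAt_const t x))
  · exact (hD (t, x)).comp_hasDerivAt x ((hasDerivAt_const x t).prodMk (hasDerivAt_id x))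

lemma hasDerivAt_intervalIntegral_of_continuous_deriv {g g' : ℝ → ℝ → ℝ}
    (hg : ∀ t, Continuous (g t)) (hg' : Continuous (fun p : ℝ × ℝ => g' p.1 p.2))
    (hderiv : ∀ t x, HasDerivAt (fun τ => g τ x) (g' t x) t) (a b t : ℝ) :
    HasDerivAt (fun τ => ∫ x in a..b, g τ x) (∫ x in a..b, g' t x) t := by
  obtain ⟨C, hC⟩ := ((isCompact_closedBall t 1).prod
    (isCompact_uIcc (a := a) (b := b))).exists_bound_of_continuousOn hg'.continuousOn
  refine (intervalIntegral.hasDerivAt_integral_of_dominated_loc_of_deriv_le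
    (bound := fun _ => C) (Metric.ball_mem_nhds t one_pos)
    (Eventually.of_forall fun τ => (hg τ).aestronglyMeasurable)
    ((hg t).intervalIntegrable _ _)
    (hg'.comp (Continuous.prodMk_right t)).aestronglyMeasurable ?_
    intervalIntegrable_const ?_).2
  · exact Eventually.of_forall fun x hx τ hτ =>
      hC (τ, x) ⟨Metric.ball_subset_closedBall hτ, Set.uIoc_subset_uIcc hx⟩
  · exact Eventually.of_forall fun x _ τ _ => hderiv τ x

/-- **Equation (23) of the paper.** Differentiating `‖e(t,·)‖₂²` along the error
dynamics `e_t = −K_p e + [(ρᵈ − e) d]_x` on the circle `S = [-π, π]`. -/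
theorem norm_sq_derivative_velocity_disturbance
    (ρd : ℝ → ℝ → ℝ)
    (hρd : ContDiff ℝ 1 (fun p : ℝ × ℝ => ρd p.1 p.2))
    (hρdper : ∀ t, Function.Periodic (ρd t) (2 * Real.pi))
    (d : ℝ → ℝ → ℝ)
    (hd : ContDiff ℝ 1 (fun p : ℝ × ℝ => d p.1 p.2))
    (hdper : ∀ t, Function.Periodic (d t) (2 * Real.pi))
    (Kp : ℝ)
    (e : ℝ → ℝ → ℝ)
    (he1 : ContDiff ℝ 1 (fun p : ℝ × ℝ => e p.1 p.2))
    (heper : ∀ t, Function.Periodic (e t) (2 * Real.pi))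
    (hdyn : ∀ t, 0 ≤ t → ∀ x : ℝ,
      HasDerivAt (fun τ => e τ x)
        (-Kp * e t x
          + deriv (fun y => (ρd t y - e t y) * d t y) x) t) :
    ∀ t, 0 ≤ t →
      HasDerivAt (fun τ => ∫ x in (-Real.pi)..Real.pi, e τ x ^ 2)
        (-2 * Kp * (∫ x in (-Real.pi)..Real.pi, e t x ^ 2)
          - (∫ x in (-Real.pi)..Real.pi, e t x ^ 2 * deriv (d t) x)
          + 2 * ∫ x in (-Real.pi)..Real.pi,
              (e t x * deriv (ρd t) x * d t x
                + e t x * ρd t x * deriv (d t) x)) t := by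
  intro t ht
  obtain ⟨e₁, e₂, he₁c, he₂c, he₁, he₂⟩ := he1.exists_continuous_partial_derivs
  obtain ⟨-, d₂, -, hd₂c, -, hd₂⟩ := hd.exists_continuous_partial_derivs
  obtain ⟨-, r₂, -, hr₂c, -, hr₂⟩ := hρd.exists_continuous_partial_derivs
  have hslice : ∀ {f : ℝ → ℝ → ℝ}, Continuous (fun p : ℝ × ℝ => f p.1 p.2) →
      ∀ s, Continuous (f s) := fun hf s => hf.comp (Continuous.prodMk_right s)
  have hec := hslice he1.continuous
  have hdc := hslice hd.continuous t
  have hrc := hslice hρd.continuous t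
  have he₂t := hslice he₂c t
  have hd₂t := hslice hd₂c t
  have hr₂t := hslice hr₂c t
  have het := hec t
  have key := hasDerivAt_intervalIntegral_of_continuous_deriv
    (g := fun τ x => e τ x ^ 2) (g' := fun τ x => 2 * e τ x * e₁ τ x)
    (fun τ => (hec τ).pow 2) ((continuous_const.mul he1.continuous).mul he₁c)
    (fun τ x => by simpa using (he₁ τ x).fun_pow 2) (-π) π t
  convert key using 1
  have hE : ∀ x, e₁ t x = -Kp * e t x
      + ((r₂ t x - e₂ t x) * d t x + (ρd t x - e t x) * d₂ t x) := fun x => by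
    rw [(he₁ t x).unique (hdyn t ht x), (((hr₂ t x).fun_sub (he₂ t x)).fun_mul (hd₂ t x)).deriv]
  have hboundary : ∫ x in (-π)..π, (2 * e t x * e₂ t x * d t x + e t x ^ 2 * d₂ t x) = 0 := by
    rw [intervalIntegral.integral_eq_sub_of_hasDerivAt (f := fun x => e t x ^ 2 * d t x)
      (fun x _ => by simpa using ((he₂ t x).fun_pow 2).fun_mul (hd₂ t x))
      (Continuous.intervalIntegrable (by fun_prop) _ _)]
    have h1 := heper t (-π)
    have h2 := hdper t (-π)
    rw [show -π + 2 * π = π by ring] at h1 h2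
    rw [h1, h2, sub_self]
  simp only [(hd₂ t _).deriv, (hr₂ t _).deriv, hE]
  rw [← sub_zero (_ + _), ← hboundary, ← intervalIntegral.integral_const_mul,
    ← intervalIntegral.integral_const_mul, ← intervalIntegral.integral_sub,
    ← intervalIntegral.integral_add, ← intervalIntegral.integral_sub]
  · exact intervalIntegral.integral_congr fun x _ => by ring
  all_goals exact Continuous.intervalIntegrable (by fun_prop) _ _
end
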